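/- There exists a constant C > 0, depending only on Ω, r, u and κ, such that for every f ∈ C^∞ on the closure of Ω: ‖f‖_{H^{1, 1/(2κ)-1/2}} ≤ C ( ‖L̃_1 f‖_{H^{0, 1/(2κ)-1/2}} + ‖f‖_{H^{0, 1/(2κ)-1/2}} ); that is, one weighted derivative of f with weight r^{1/(2κ)-1/2} is controlled by the weighted L^2 norms of L̃_1 f and of f. -/

import Mathlib

open Set MeasureTheory

/-- Partial derivative in the `i`-th coordinate direction. -/
noncomputable def pd {n : ℕ} (i : Fin n) (f : (Fin n → ℝ) → ℝ) : (Fin n → ℝ) → ℝ :=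
  fun x => fderiv ℝ f x (Pi.single i 1)

/-- Iterated partial derivative `∂^β f` for an (ordered) multi-index `β` of length `k`. -/
noncomputable def mderiv {n k : ℕ} (β : Fin k → Fin n) (f : (Fin n → ℝ) → ℝ) :
    (Fin n → ℝ) → ℝ :=
  (List.ofFn β).foldr pd f

/-- `Ω` has a smooth boundary: it is the superlevel set of a smooth defining function whose
gradient does not vanish on the boundary. -/
def HasSmoothBoundary {n : ℕ} (Ω : Set (Fin n → ℝ)) : Prop :=
  ∃ ρ : (Fin n → ℝ) → ℝ, ContDiff ℝ (⊤ : ℕ∞) ρ ∧ Ω = {x | 0 < ρ x} ∧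
    ∀ x ∈ frontier Ω, ρ x = 0 ∧ fderiv ℝ ρ x ≠ 0

/-- The matrix field `H^{ij} = δ^{ij} - u^i u^j / (u^0)²`. -/
noncomputable def Hcoef (u : (Fin 3 → ℝ) → Fin 4 → ℝ) (i j : Fin 3)
    (x : Fin 3 → ℝ) : ℝ :=
  (if i = j then (1:ℝ) else 0) - u x i.succ * u x j.succ / (u x 0) ^ 2

/-- The degenerate elliptic operator
`L̃₁ f = (κ+1) H^{ij} (r ∂_i ∂_j f + (1/κ)(∂_i r)(∂_j f))`. -/
noncomputable def L1t (κ : ℝ) (r : (Fin 3 → ℝ) → ℝ) (u : (Fin 3 → ℝ) → Fin 4 → ℝ)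
    (f : (Fin 3 → ℝ) → ℝ) (x : Fin 3 → ℝ) : ℝ :=
  (κ + 1) * ∑ i, ∑ j, Hcoef u i j x *
    (r x * pd i (pd j f) x + (1/κ) * pd i r x * pd j f x)

/-- The weighted elliptic operator (up to sign, `L̂₁` of the paper)
`A f = -(κ+1) r^{1-1/κ} ∂_i (r^{1/κ} H^{ij} ∂_j f)`. -/
noncomputable def Aop (κ : ℝ) (r : (Fin 3 → ℝ) → ℝ) (u : (Fin 3 → ℝ) → Fin 4 → ℝ)
    (f : (Fin 3 → ℝ) → ℝ) (x : Fin 3 → ℝ) : ℝ :=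
  -(κ + 1) * r x ^ ((1:ℝ) - 1/κ) *
    ∑ i, pd i (fun y => r y ^ (1/κ) * ∑ j, Hcoef u i j y * pd j f y) x

/-- The weighted Sobolev norm with weight `r`:
`‖f‖_{H^{j,σ}}² = Σ_{|β| ≤ j} ∫_Ω r^{2σ} |∂^β f|² dx`. -/
noncomputable def rSobNorm (Ω : Set (Fin 3 → ℝ)) (r : (Fin 3 → ℝ) → ℝ) (j : ℕ) (σ : ℝ)
    (f : (Fin 3 → ℝ) → ℝ) : ℝ :=
  Real.sqrt (∑ k ∈ Finset.range (j + 1), ∑ β : Fin k → Fin 3,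
    ∫ x in Ω, r x ^ (2 * σ) * (mderiv β f x) ^ 2)

open Filter Topology

theorem uniqueDiffOn_closure_of_hasSmoothBoundary {n : ℕ} {Ω : Set (Fin n → ℝ)}
    (hΩo : IsOpen Ω) (hΩs : HasSmoothBoundary Ω) : UniqueDiffOn ℝ (closure Ω) := by
  obtain ⟨ρ, hρ, hΩ, hfr⟩ := hΩs
  intro x hx
  by_cases hxΩ : x ∈ Ω
  · exact (hΩo.uniqueDiffWithinAt hxΩ).closure
  have hxf : x ∈ frontier Ω := by rw [hΩo.frontier_eq]; exact ⟨hx, hxΩ⟩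
  obtain ⟨h0, hne⟩ := hfr x hxf
  set L := fderiv ℝ ρ x with hL
  have hd : HasFDerivAt ρ L x := (hρ.differentiable (by simp)).differentiableAt.hasFDerivAt
  have hcone : ∀ v, 0 < L v → v ∈ tangentConeAt ℝ (closure Ω) x := by
    intro v hv
    refine mem_tangentConeAt_of_add_smul_mem (α := ℝ) (l := 𝓝[>] (0:ℝ)) (c := id)
      (tendsto_id'.mpr <| nhdsGT_le_nhdsNE 0) ?_
    have hline : HasDerivAt (fun t : ℝ => ρ (x + t • v)) (L v) 0 := by
      have hg : HasDerivAt (fun t : ℝ => x + t • v) v 0 := by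
        simpa using ((hasDerivAt_id (0:ℝ)).smul_const v).const_add x
      have hd' : HasFDerivAt ρ L (x + (0:ℝ) • v) := by simpa using hd
      exact hd'.comp_hasDerivAt (0:ℝ) hg
    have hslope := hline.tendsto_slope_zero_right
    filter_upwards [hslope.eventually (lt_mem_nhds hv), self_mem_nhdsWithin] with t ht htpos
    apply subset_closure
    rw [hΩ]
    simp only [zero_add, zero_smul, add_zero, h0, sub_zero, smul_eq_mul] at ht
    exact (pos_iff_pos_of_mul_pos ht).1 (inv_pos.2 htpos)
  refine ⟨?_, subset_closure hx⟩
  have hex : ∃ v, 0 < L v := by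
    obtain ⟨v, hv⟩ : ∃ v, L v ≠ 0 := by
      by_contra! h
      exact hne (ContinuousLinearMap.ext h)
    rcases lt_or_gt_of_ne hv with h | h
    · exact ⟨-v, by simpa using h⟩
    · exact ⟨v, h⟩
  obtain ⟨v, hv⟩ := hex
  have hspan : Submodule.span ℝ (tangentConeAt ℝ (closure Ω) x) = ⊤ := by
    rw [eq_top_iff]
    intro w _
    obtain ⟨c, hc⟩ : ∃ c : ℝ, 0 < L (w + c • v) := by
      refine ⟨(1 - L w) / L v, ?_⟩
      simp only [map_add, map_smul, smul_eq_mul]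
      rw [div_mul_cancel₀ _ hv.ne']
      linarith
    have := Submodule.sub_mem _ (Submodule.subset_span (hcone _ hc) :
        _ ∈ Submodule.span ℝ (tangentConeAt ℝ (closure Ω) x))
      (Submodule.smul_mem _ c (Submodule.subset_span (hcone _ hv)))
    simpa using this
  rw [hspan]
  simp

/-- Partial derivative in the `i`-th coordinate direction, relative to the set `K`. -/
noncomputable def pdWithin {n : ℕ} (K : Set (Fin n → ℝ)) (i : Fin n) (f : (Fin n → ℝ) → ℝ) :
    (Fin n → ℝ) → ℝ :=
  fun x => fderivWithin ℝ f K x (Pi.single i 1)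

section PdWithin

variable {n : ℕ} {K Ω : Set (Fin n → ℝ)} {f g : (Fin n → ℝ) → ℝ}

theorem ContDiffOn.pdWithin (hK : UniqueDiffOn ℝ K) (hf : ContDiffOn ℝ (⊤ : ℕ∞) f K)
    (i : Fin n) : ContDiffOn ℝ (⊤ : ℕ∞) (pdWithin K i f) K :=
  (hf.fderivWithin hK (by simp)).clm_apply contDiffOn_const

theorem pdWithin_mul (hK : UniqueDiffOn ℝ K) (hf : ContDiffOn ℝ (⊤ : ℕ∞) f K)
    (hg : ContDiffOn ℝ (⊤ : ℕ∞) g K) (i : Fin n) {x : Fin n → ℝ} (hx : x ∈ K) :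
    pdWithin K i (fun y => f y * g y) x
      = pdWithin K i f x * g x + f x * pdWithin K i g x := by
  have h1 := hf.differentiableOn (by simp) x hx
  have h2 := hg.differentiableOn (by simp) x hx
  simp only [_root_.pdWithin]
  rw [fderivWithin_fun_mul (hK x hx) h1 h2]
  simp
  ring

theorem pdWithin_eq_pd_of_mem_nhds (f : (Fin n → ℝ) → ℝ) (i : Fin n) {x : Fin n → ℝ}
    (hx : K ∈ 𝓝 x) : pdWithin K i f x = pd i f x := by
  simp only [_root_.pdWithin, pd, fderivWithin_of_mem_nhds hx]

theorem pdWithin_pdWithin_eq_pd_pd (hΩo : IsOpen Ω) (hΩK : Ω ⊆ K) (f : (Fin n → ℝ) → ℝ)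
    (i j : Fin n) {x : Fin n → ℝ} (hx : x ∈ Ω) :
    pdWithin K i (pdWithin K j f) x = pd i (pd j f) x := by
  rw [pdWithin_eq_pd_of_mem_nhds _ _ (mem_of_superset (hΩo.mem_nhds hx) hΩK)]
  have : pdWithin K j f =ᶠ[𝓝 x] pd j f := by
    filter_upwards [hΩo.mem_nhds hx] with y hy
    exact pdWithin_eq_pd_of_mem_nhds _ _ (mem_of_superset (hΩo.mem_nhds hy) hΩK)
  simp only [pd, this.fderiv_eq]

theorem pd_comm_of_contDiffAt {x : Fin n → ℝ} (hf : ContDiffAt ℝ 2 f x) (i j : Fin n) :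
    pd i (pd j f) x = pd j (pd i f) x := by
  have hsymm := hf.isSymmSndFDerivAt (by simp)
  have hd : DifferentiableAt ℝ (fderiv ℝ f) x :=
    (hf.fderiv_right (m := 1) (by norm_num)).differentiableAt (by simp)
  have key : ∀ i j : Fin n, pd i (pd j f) x
      = fderiv ℝ (fderiv ℝ f) x (Pi.single i 1) (Pi.single j 1) := by
    intro i j
    have := (hd.hasFDerivAt.clm_apply
      (hasFDerivAt_const (Pi.single j (1:ℝ) : Fin n → ℝ) x)).fderiv
    have hpd : pd j f = fun y => fderiv ℝ f y (Pi.single j 1) := rfl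
    rw [hpd, pd, this]
    simp
  rw [key, key, hsymm.eq]

theorem pdWithin_comm (hΩo : IsOpen Ω) (hΩK : Ω ⊆ K) (hf : ContDiffOn ℝ (⊤ : ℕ∞) f K)
    (i j : Fin n) {x : Fin n → ℝ} (hx : x ∈ Ω) :
    pdWithin K i (pdWithin K j f) x = pdWithin K j (pdWithin K i f) x := by
  rw [pdWithin_pdWithin_eq_pd_pd hΩo hΩK f i j hx, pdWithin_pdWithin_eq_pd_pd hΩo hΩK f j i hx]
  refine pd_comm_of_contDiffAt ?_ i j
  exact (hf.contDiffAt (mem_of_superset (hΩo.mem_nhds hx) hΩK)).of_le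
    (WithTop.coe_le_coe.2 (le_top : (2 : ℕ∞) ≤ ⊤))

end PdWithin

section Cutoff

variable {n : ℕ} {Ω : Set (Fin n → ℝ)} {r g : (Fin n → ℝ) → ℝ}

theorem integral_fderiv_eq_zero_of_hasCompactSupport {h : (Fin n → ℝ) → ℝ} (hh : ContDiff ℝ 1 h)
    (hc : HasCompactSupport h) (v : Fin n → ℝ) : ∫ x, fderiv ℝ h x v = 0 := by
  have hintegral : Integrable h := hh.continuous.integrable_of_hasCompactSupport hc
  have hintegral' : Integrable (fun x => fderiv ℝ h x v) :=
    ((hh.continuous_fderiv (by simp)).clm_apply continuous_const).integrable_of_hasCompactSupport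
      (hc.fderiv_apply ℝ v)
  have := integral_mul_fderiv_eq_neg_fderiv_mul_of_integrable (μ := volume) (f := h)
    (g := fun _ => (1:ℝ)) (v := v) (by simpa using hintegral') (by simp) (by simpa using hintegral)
    (fun x _ => (hh.differentiable (by simp)).differentiableAt)
    (fun x _ => differentiableAt_const _)
  simpa using this.symm

theorem integral_cutoff_eq_zero (hΩo : IsOpen Ω) (hΩb : Bornology.IsBounded Ω)
    (hr : ContDiffOn ℝ (⊤ : ℕ∞) r (closure Ω)) (hr0 : ∀ x ∈ frontier Ω, r x = 0)
    (hg : ContDiffOn ℝ (⊤ : ℕ∞) g (closure Ω)) {ψ : ℝ → ℝ} (hψ : ContDiff ℝ 1 ψ) {ε : ℝ}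
    (hε : 0 < ε) (hψ0 : ∀ s ≤ ε, ψ s = 0) (i : Fin n) :
    ∫ x in Ω, (deriv ψ (r x) * pdWithin (closure Ω) i r x * g x
      + ψ (r x) * pdWithin (closure Ω) i g x) = 0 := by
  set S := closure Ω ∩ r ⁻¹' Ici ε with hS
  have hScl : IsClosed S := hr.continuousOn.preimage_isClosed_of_isClosed isClosed_closure isClosed_Ici
  have hScomp : IsCompact S := hΩb.isCompact_closure.of_isClosed_subset hScl inter_subset_left
  have hSΩ : S ⊆ Ω := by
    rintro x ⟨hx, hxr⟩
    by_contra hxΩ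
    have : r x = 0 := hr0 x (by rw [hΩo.frontier_eq]; exact ⟨hx, hxΩ⟩)
    simp only [mem_preimage, mem_Ici, this] at hxr
    linarith
  have hKn : ∀ x ∈ Ω, closure Ω ∈ 𝓝 x := fun x hx =>
    mem_of_superset (hΩo.mem_nhds hx) subset_closure
  set h : (Fin n → ℝ) → ℝ := Ω.indicator (fun x => ψ (r x) * g x) with hh
  have hzero : ∀ x ∉ S, h x = 0 := by
    intro x hx
    by_cases hxΩ : x ∈ Ω
    · have : r x ≤ ε := by
        by_contra! hlt
        exact hx ⟨subset_closure hxΩ, hlt.le⟩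
      simp [hh, hxΩ, hψ0 _ this]
    · simp [hh, hxΩ]
  have hevΩ : ∀ x ∈ Ω, h =ᶠ[𝓝 x] fun x => ψ (r x) * g x := fun x hx => by
    filter_upwards [hΩo.mem_nhds hx] with y hy
    simp [hh, hy]
  have hev0 : ∀ x ∉ Ω, h =ᶠ[𝓝 x] fun _ => 0 := fun x hx => by
    filter_upwards [hScl.isOpen_compl.mem_nhds (fun hxS => hx (hSΩ hxS))] with y hy
    exact hzero y hy
  have hle : (1 : WithTop ℕ∞) ≤ ((⊤ : ℕ∞) : WithTop ℕ∞) := by simp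
  have hcd : ContDiff ℝ 1 h := by
    rw [contDiff_iff_contDiffAt]
    intro x
    by_cases hx : x ∈ Ω
    · have h1 := (hr.contDiffAt (hKn x hx)).of_le hle
      have h2 := (hg.contDiffAt (hKn x hx)).of_le hle
      exact ((hψ.contDiffAt.comp x h1).mul h2).congr_of_eventuallyEq (hevΩ x hx)
    · exact contDiffAt_const.congr_of_eventuallyEq (hev0 x hx)
  have hintegral := integral_fderiv_eq_zero_of_hasCompactSupport hcd
    (HasCompactSupport.intro hScomp hzero) (Pi.single i 1)
  rw [← hintegral, ← setIntegral_eq_integral_of_forall_compl_eq_zero (s := Ω)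
    (f := fun x => fderiv ℝ h x (Pi.single i 1))]
  · refine setIntegral_congr_fun hΩo.measurableSet fun x hx => ?_
    have h1 := ((hr.contDiffAt (hKn x hx)).differentiableAt (by simp)).hasFDerivAt
    have h2 := ((hg.contDiffAt (hKn x hx)).differentiableAt (by simp)).hasFDerivAt
    have h3 := ((hψ.differentiable (by simp)) (r x)).hasDerivAt.comp_hasFDerivAt x h1
    have h4 := (h3.mul h2).fderiv
    rw [(hevΩ x hx).fderiv_eq]
    simp only [pdWithin_eq_pd_of_mem_nhds _ _ (hKn x hx), pd]
    change _ = fderiv ℝ (ψ ∘ r * g) x _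
    rw [h4]
    simp
    ring
  · intro x hx
    rw [(hev0 x hx).fderiv_eq]
    simp

end Cutoff

/-- A truncation of `s ↦ s ^ a` vanishing for `s ≤ 1 / m`. -/
noncomputable def truncRpow (a : ℝ) (m : ℕ) (s : ℝ) : ℝ :=
  Real.smoothTransition (m * s - 1) * s ^ a

section TruncRpow

variable {a : ℝ} {m : ℕ} {s : ℝ}

theorem truncRpow_of_le (hm : 0 < m) (hs : s ≤ 1 / m) : truncRpow a m s = 0 := by
  have hm' : (0:ℝ) < m := by exact_mod_cast hm
  rw [truncRpow, Real.smoothTransition.zero_of_nonpos, zero_mul]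
  rw [le_div_iff₀ hm'] at hs
  linarith

theorem contDiff_truncRpow (a : ℝ) (hm : 0 < m) : ContDiff ℝ 1 (truncRpow a m) := by
  have hm' : (0:ℝ) < m := by exact_mod_cast hm
  rw [contDiff_iff_contDiffAt]
  intro s
  rcases lt_or_ge s (1 / m) with hs | hs
  · refine (contDiffAt_const (c := (0:ℝ))).congr_of_eventuallyEq ?_
    filter_upwards [Iio_mem_nhds hs] with t ht
    exact truncRpow_of_le hm (le_of_lt ht)
  · have hs0 : s ≠ 0 := (lt_of_lt_of_le (by positivity) hs).ne'
    refine ContDiffAt.mul ?_ (Real.contDiffAt_rpow_const_of_ne hs0)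
    exact (Real.smoothTransition.contDiff (n := 1)).contDiffAt.comp s
      ((contDiffAt_const.mul contDiffAt_id).sub contDiffAt_const)

theorem deriv_truncRpow (hs : 0 < s) :
    deriv (truncRpow a m) s = (m * s * deriv Real.smoothTransition (m * s - 1)
      + a * Real.smoothTransition (m * s - 1)) * s ^ (a - 1) := by
  have h1 : HasDerivAt (fun s : ℝ => (m:ℝ) * s - 1) (m:ℝ) s := by
    simpa using ((hasDerivAt_id s).const_mul (m:ℝ)).sub_const 1
  have h2 : HasDerivAt Real.smoothTransition (deriv Real.smoothTransition (m * s - 1))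
      (m * s - 1) :=
    (((Real.smoothTransition.contDiff (n := 1)).differentiable (by simp)) _).hasDerivAt
  have h3 := (h2.comp s h1).mul (Real.hasDerivAt_rpow_const (p := a) (Or.inl hs.ne'))
  have h4 : deriv (truncRpow a m) s = _ := h3.deriv
  rw [h4, Real.rpow_sub_one hs.ne']
  simp only [Function.comp]
  field_simp

theorem exists_deriv_smoothTransition_bound :
    ∃ C, ∀ t : ℝ, |t * deriv Real.smoothTransition (t - 1)| ≤ C := by
  have hcont : Continuous (deriv Real.smoothTransition) :=
    (Real.smoothTransition.contDiff (n := 1)).continuous_deriv (by simp)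
  have hc : HasCompactSupport (fun t : ℝ => t * deriv Real.smoothTransition (t - 1)) := by
    refine HasCompactSupport.intro (isCompact_Icc (a := (1:ℝ)) (b := 2)) fun t ht => ?_
    have : deriv Real.smoothTransition (t - 1) = 0 := by
      rw [mem_Icc, not_and_or, not_le, not_le] at ht
      rcases ht with ht | ht
      · have : Real.smoothTransition =ᶠ[𝓝 (t - 1)] fun _ => (0:ℝ) := by
          filter_upwards [Iio_mem_nhds (show t - 1 < 0 by linarith)] with y hy
          exact Real.smoothTransition.zero_of_nonpos (le_of_lt hy)
        rw [this.deriv_eq]; simp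
      · have : Real.smoothTransition =ᶠ[𝓝 (t - 1)] fun _ => (1:ℝ) := by
          filter_upwards [Ioi_mem_nhds (show 1 < t - 1 by linarith)] with y hy
          exact Real.smoothTransition.one_of_one_le (le_of_lt hy)
        rw [this.deriv_eq]; simp
    rw [this, mul_zero]
  obtain ⟨C, hC⟩ := hc.exists_bound_of_continuous
    (continuous_id.mul (hcont.comp (continuous_id.sub continuous_const)))
  exact ⟨C, fun t => hC t⟩

theorem exists_deriv_truncRpow_bound (ha : 0 < a) :
    ∃ C, ∀ (m : ℕ) (s : ℝ), 0 < s → |deriv (truncRpow a m) s| ≤ C * s ^ (a - 1) := by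
  obtain ⟨C, hC⟩ := exists_deriv_smoothTransition_bound
  refine ⟨C + a, fun m s hs => ?_⟩
  rw [deriv_truncRpow hs, abs_mul, abs_of_nonneg (Real.rpow_nonneg hs.le (a - 1))]
  refine mul_le_mul_of_nonneg_right ((abs_add_le _ _).trans (add_le_add (hC _) ?_))
    (Real.rpow_nonneg hs.le _)
  rw [abs_mul, abs_of_pos ha, abs_of_nonneg (Real.smoothTransition.nonneg _)]
  exact mul_le_of_le_one_right ha.le (Real.smoothTransition.le_one _)

theorem abs_truncRpow_le (hs : 0 ≤ s) : |truncRpow a m s| ≤ s ^ a := by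
  rw [truncRpow, abs_mul, abs_of_nonneg (Real.smoothTransition.nonneg _),
    abs_of_nonneg (Real.rpow_nonneg hs a)]
  exact mul_le_of_le_one_left (Real.rpow_nonneg hs a) (Real.smoothTransition.le_one _)

theorem eventually_truncRpow_eq (a : ℝ) (hs : 0 < s) :
    ∀ᶠ m : ℕ in atTop, truncRpow a m s = s ^ a ∧
      deriv (truncRpow a m) s = a * s ^ (a - 1) := by
  filter_upwards [tendsto_natCast_atTop_atTop.eventually_gt_atTop (2 / s)] with m hm
  rw [div_lt_iff₀ hs] at hm
  have key : ∀ t, 2 / (m:ℝ) < t → truncRpow a m t = t ^ a := by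
    intro t ht
    have hm0 : (0:ℝ) < m := by
      by_contra! h
      nlinarith
    rw [div_lt_iff₀ hm0] at ht
    rw [truncRpow, Real.smoothTransition.one_of_one_le (by linarith), one_mul]
  have hm0 : (0:ℝ) < m := by
    by_contra! h
    nlinarith
  have hlt : 2 / (m:ℝ) < s := by rw [div_lt_iff₀ hm0]; linarith
  refine ⟨key s hlt, ?_⟩
  have : truncRpow a m =ᶠ[𝓝 s] fun t => t ^ a := by
    filter_upwards [Ioi_mem_nhds hlt] with t ht
    exact key t ht
  rw [this.deriv_eq]
  exact (Real.hasDerivAt_rpow_const (Or.inl hs.ne')).deriv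

theorem le_deriv_truncRpow (hm : 0 < m) (hs : 2 / m ≤ s) :
    a * s ^ (a - 1) ≤ deriv (truncRpow a m) s := by
  have hm' : (0:ℝ) < m := by exact_mod_cast hm
  have hs0 : 0 < s := lt_of_lt_of_le (by positivity) hs
  rw [deriv_truncRpow hs0]
  refine mul_le_mul_of_nonneg_right ?_ (Real.rpow_nonneg hs0.le _)
  rw [div_le_iff₀ hm'] at hs
  rw [Real.smoothTransition.one_of_one_le (by linarith)]
  have := (Real.smoothTransition.monotone.deriv_nonneg : 0 ≤ deriv Real.smoothTransition (m * s - 1))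
  have : 0 ≤ m * s * deriv Real.smoothTransition (m * s - 1) := by positivity
  linarith

theorem deriv_truncRpow_nonneg (ha : 0 ≤ a) (hs : 0 < s) :
    0 ≤ deriv (truncRpow a m) s := by
  rw [deriv_truncRpow hs]
  have h1 := (Real.smoothTransition.monotone.deriv_nonneg :
    0 ≤ deriv Real.smoothTransition (m * s - 1))
  have h2 := Real.smoothTransition.nonneg (m * s - 1)
  positivity

end TruncRpow

section Weight

variable {n : ℕ} {Ω : Set (Fin n → ℝ)} {r g : (Fin n → ℝ) → ℝ} {a : ℝ}

theorem ContinuousOn.integrableOn_of_isBounded (hΩb : Bornology.IsBounded Ω)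
    (hg : ContinuousOn g (closure Ω)) : IntegrableOn g Ω :=
  (hg.integrableOn_compact hΩb.isCompact_closure).mono_set subset_closure

theorem nonneg_on_closure (hΩo : IsOpen Ω) (hrpos : ∀ x ∈ Ω, 0 < r x)
    (hr0 : ∀ x ∈ frontier Ω, r x = 0) : ∀ x ∈ closure Ω, 0 ≤ r x := by
  intro x hx
  by_cases hxΩ : x ∈ Ω
  · exact (hrpos x hxΩ).le
  · exact (hr0 x (by rw [hΩo.frontier_eq]; exact ⟨hx, hxΩ⟩)).ge

theorem integrableOn_rpow_sub_one (hΩo : IsOpen Ω) (hΩb : Bornology.IsBounded Ω)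
    (hK : UniqueDiffOn ℝ (closure Ω)) (hr : ContDiffOn ℝ (⊤ : ℕ∞) r (closure Ω))
    (hrpos : ∀ x ∈ Ω, 0 < r x) (hr0 : ∀ x ∈ frontier Ω, r x = 0) (ha : 0 < a) {c : ℝ} (hc : 0 < c)
    (hgrad : ∀ x ∈ Ω, c ≤ ∑ i, pdWithin (closure Ω) i r x ^ 2 + r x) :
    IntegrableOn (fun x => r x ^ (a - 1)) Ω := by
  set K := closure Ω with hKdef
  have hKc : IsCompact K := hΩb.isCompact_closure
  have hrK := nonneg_on_closure hΩo hrpos hr0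
  set q : (Fin n → ℝ) → ℝ := fun x => ∑ i, pdWithin K i r x ^ 2 with hq
  have hDr : ∀ i, ContDiffOn ℝ (⊤ : ℕ∞) (pdWithin K i r) K := fun i => hr.pdWithin hK i
  have hDDr : ∀ i, ContDiffOn ℝ (⊤ : ℕ∞) (pdWithin K i (pdWithin K i r)) K :=
    fun i => (hDr i).pdWithin hK i
  have hqc : ContinuousOn q K := continuousOn_finsetSum _ fun i _ => (hDr i).continuousOn.pow 2
  have hqnn : ∀ x, 0 ≤ q x := fun x => Finset.sum_nonneg fun i _ => sq_nonneg _
  have hra : ContinuousOn (fun x => r x ^ a) K :=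
    hr.continuousOn.rpow_const fun _ _ => Or.inr ha.le
  set lap : (Fin n → ℝ) → ℝ := fun x => ∑ i, pdWithin K i (pdWithin K i r) x with hlap
  have hlapc : ContinuousOn lap K := continuousOn_finsetSum _ fun i _ => (hDDr i).continuousOn
  have hcl : ∀ ε, IsClosed (K ∩ r ⁻¹' Ici ε) := fun ε =>
    hr.continuousOn.preimage_isClosed_of_isClosed isClosed_closure isClosed_Ici
  have hmain : Integrable (fun x => r x ^ (a - 1) * q x) (volume.restrict Ω) := by
    refine AECover.integrable_of_integral_norm_bounded (l := atTop)
      (φ := fun m : ℕ => K ∩ r ⁻¹' Ici (2 / ((m + 1 : ℕ) : ℝ))) ?_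
      (a⁻¹ * ∫ x in Ω, r x ^ a * |lap x|) ?_ ?_
    · refine ⟨?_, fun m => (hcl _).measurableSet⟩
      filter_upwards [ae_restrict_mem hΩo.measurableSet] with x hx
      have hlim : Tendsto (fun m : ℕ => 2 / ((m + 1 : ℕ) : ℝ)) atTop (𝓝 0) :=
        (tendsto_const_nhds.div_atTop tendsto_natCast_atTop_atTop).comp (tendsto_add_atTop_nat 1)
      filter_upwards [hlim.eventually (gt_mem_nhds (hrpos x hx))] with m hm
      exact ⟨subset_closure hx, le_of_lt hm⟩
    · intro m
      refine IntegrableOn.restrict ?_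
      have hcomp : IsCompact (K ∩ r ⁻¹' Ici (2 / ((m + 1 : ℕ) : ℝ))) :=
        hKc.of_isClosed_subset (hcl _) inter_subset_left
      refine ContinuousOn.integrableOn_compact hcomp ?_
      refine ((hr.continuousOn.mono inter_subset_left).rpow_const fun x hx => Or.inl ?_).mul
        (hqc.mono inter_subset_left)
      have h1 : (0:ℝ) < 2 / ((m + 1 : ℕ) : ℝ) := by positivity
      exact (lt_of_lt_of_le h1 hx.2).ne'
    · refine Eventually.of_forall fun m => ?_
      set ψ := truncRpow a (m + 1) with hψ
      have hψc : ContDiff ℝ 1 ψ := contDiff_truncRpow a m.succ_pos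
      have hcut : ∀ i, ∫ x in Ω, (deriv ψ (r x) * pdWithin K i r x * pdWithin K i r x
          + ψ (r x) * pdWithin K i (pdWithin K i r) x) = 0 := fun i =>
        integral_cutoff_eq_zero hΩo hΩb hr hr0 (hDr i) hψc (ε := 1 / ((m + 1 : ℕ) : ℝ))
          (by positivity) (fun s hs => truncRpow_of_le m.succ_pos hs) i
      have hψr : ContinuousOn (fun x => ψ (r x)) K := hψc.continuous.comp_continuousOn hr.continuousOn
      have hψr' : ContinuousOn (fun x => deriv ψ (r x)) K :=
        (hψc.continuous_deriv (by simp)).comp_continuousOn hr.continuousOn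
      have hi1 : IntegrableOn (fun x => deriv ψ (r x) * q x) Ω :=
        (hψr'.mul hqc).integrableOn_of_isBounded hΩb
      have hi2 : IntegrableOn (fun x => ψ (r x) * lap x) Ω :=
        (hψr.mul hlapc).integrableOn_of_isBounded hΩb
      have hsum : ∫ x in Ω, (deriv ψ (r x) * q x + ψ (r x) * lap x) = 0 := by
        rw [← Finset.sum_eq_zero (s := Finset.univ) fun i _ => hcut i, ← integral_finsetSum]
        · congr 1
          ext x
          simp only [hq, hlap, Finset.mul_sum, ← Finset.sum_add_distrib]
          refine Finset.sum_congr rfl fun i _ => by ring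
        · intro i _
          exact (((hψr'.mul (hDr i).continuousOn).mul (hDr i).continuousOn).add
            (hψr.mul (hDDr i).continuousOn)).integrableOn_of_isBounded hΩb
      rw [integral_add hi1 hi2] at hsum
      have hle1 : ∫ x in K ∩ r ⁻¹' Ici (2 / ((m + 1 : ℕ) : ℝ)), ‖r x ^ (a - 1) * q x‖
          ∂(volume.restrict Ω) ≤ ∫ x in Ω, a⁻¹ * (deriv ψ (r x) * q x) := by
        refine (integral_mono_of_nonneg (ae_of_all _ fun x => norm_nonneg _)
          (hi1.const_mul a⁻¹).restrict ?_).trans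
          (setIntegral_le_integral (hi1.const_mul a⁻¹) ?_)
        · filter_upwards [ae_restrict_mem (hcl _).measurableSet] with x hx
          rw [Real.norm_of_nonneg (mul_nonneg (Real.rpow_nonneg (hrK x hx.1) _) (hqnn x)),
            ← mul_assoc]
          refine mul_le_mul_of_nonneg_right ?_ (hqnn x)
          rw [le_inv_mul_iff₀ ha]
          exact le_deriv_truncRpow m.succ_pos hx.2
        · filter_upwards [ae_restrict_mem hΩo.measurableSet] with x hx
          have := deriv_truncRpow_nonneg (m := m + 1) ha.le (hrpos x hx)
          exact mul_nonneg (inv_nonneg.2 ha.le) (mul_nonneg this (hqnn x))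
      refine hle1.trans ?_
      rw [integral_const_mul]
      refine mul_le_mul_of_nonneg_left ?_ (inv_nonneg.2 ha.le)
      have : ∫ x in Ω, deriv ψ (r x) * q x = ∫ x in Ω, -(ψ (r x) * lap x) := by
        rw [integral_neg]; linarith
      rw [this]
      refine setIntegral_mono_on hi2.neg ((hra.mul hlapc.abs).integrableOn_of_isBounded hΩb)
        hΩo.measurableSet fun x hx => ?_
      refine (neg_le_abs _).trans ?_
      rw [abs_mul]
      exact mul_le_mul_of_nonneg_right (abs_truncRpow_le (hrpos x hx).le) (abs_nonneg _)
  have htot : IntegrableOn (fun x => c⁻¹ * (r x ^ (a - 1) * q x + r x ^ a)) Ω :=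
    (Integrable.add hmain (hra.integrableOn_of_isBounded hΩb)).const_mul _
  refine Integrable.mono' htot ?_ ?_
  · refine ContinuousOn.aestronglyMeasurable ?_ hΩo.measurableSet
    exact (hr.continuousOn.mono subset_closure).rpow_const fun x hx => Or.inl (hrpos x hx).ne'
  · filter_upwards [ae_restrict_mem hΩo.measurableSet] with x hx
    have hr' := hrpos x hx
    have hw := Real.rpow_nonneg hr'.le (a - 1)
    rw [Real.norm_of_nonneg hw, le_inv_mul_iff₀ hc]
    have : r x ^ a = r x ^ (a - 1) * r x := by
      rw [Real.rpow_sub_one hr'.ne', div_mul_cancel₀ _ hr'.ne']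
    rw [this, ← mul_add, mul_comm c]
    exact mul_le_mul_of_nonneg_left (hgrad x hx) hw

theorem integrableOn_rpow_mul (hΩo : IsOpen Ω) (hΩb : Bornology.IsBounded Ω)
    (hw : IntegrableOn (fun x => r x ^ (a - 1)) Ω) (hg : ContinuousOn g (closure Ω)) :
    IntegrableOn (fun x => r x ^ (a - 1) * g x) Ω := by
  obtain ⟨C, hC⟩ := hΩb.isCompact_closure.exists_bound_of_continuousOn hg
  refine Integrable.mul_bdd (c := C) hw
    ((hg.mono subset_closure).aestronglyMeasurable hΩo.measurableSet) ?_
  filter_upwards [ae_restrict_mem hΩo.measurableSet] with x hx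
  exact hC x (subset_closure hx)

/-- The density `r ∂ᵢ g + a (∂ᵢ r) g`, equal to `r ^ (1 - a) ∂ᵢ (r ^ a g)` where `r` is positive. -/
noncomputable def weightedPd (K : Set (Fin n → ℝ)) (r : (Fin n → ℝ) → ℝ) (a : ℝ) (i : Fin n)
    (g : (Fin n → ℝ) → ℝ) (x : Fin n → ℝ) : ℝ :=
  r x * pdWithin K i g x + a * pdWithin K i r x * g x

theorem continuousOn_weightedPd {K : Set (Fin n → ℝ)} (hK : UniqueDiffOn ℝ K)
    (hr : ContDiffOn ℝ (⊤ : ℕ∞) r K) (hg : ContDiffOn ℝ (⊤ : ℕ∞) g K) (i : Fin n) :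
    ContinuousOn (weightedPd K r a i g) K :=
  (hr.continuousOn.mul (hg.pdWithin hK i).continuousOn).add
    ((continuousOn_const.mul (hr.pdWithin hK i).continuousOn).mul hg.continuousOn)

theorem weightedPd_mul_mul {K : Set (Fin n → ℝ)} (hK : UniqueDiffOn ℝ K)
    {A f : (Fin n → ℝ) → ℝ} (hA : ContDiffOn ℝ (⊤ : ℕ∞) A K) (hf : ContDiffOn ℝ (⊤ : ℕ∞) f K)
    (hg : ContDiffOn ℝ (⊤ : ℕ∞) g K) (i : Fin n) {x : Fin n → ℝ} (hx : x ∈ K) :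
    weightedPd K r a i (fun y => A y * (f y * g y)) x
      = r x * (pdWithin K i A x * (f x * g x)
          + A x * (pdWithin K i f x * g x + f x * pdWithin K i g x))
        + a * pdWithin K i r x * (A x * (f x * g x)) := by
  rw [weightedPd, pdWithin_mul hK hA (hf.mul hg) i hx, pdWithin_mul hK hf hg i hx]

theorem integral_rpow_mul_weightedPd (hΩo : IsOpen Ω) (hΩb : Bornology.IsBounded Ω)
    (hK : UniqueDiffOn ℝ (closure Ω)) (hr : ContDiffOn ℝ (⊤ : ℕ∞) r (closure Ω))
    (hrpos : ∀ x ∈ Ω, 0 < r x) (hr0 : ∀ x ∈ frontier Ω, r x = 0) (ha : 0 < a)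
    (hw : IntegrableOn (fun x => r x ^ (a - 1)) Ω) (hg : ContDiffOn ℝ (⊤ : ℕ∞) g (closure Ω))
    (i : Fin n) : ∫ x in Ω, r x ^ (a - 1) * weightedPd (closure Ω) r a i g x = 0 := by
  set K := closure Ω with hKdef
  obtain ⟨C, hC⟩ := exists_deriv_truncRpow_bound ha
  have hDr := (hr.pdWithin hK i).continuousOn
  have hDg := (hg.pdWithin hK i).continuousOn
  have hcut : ∀ m : ℕ, ∫ x in Ω, (deriv (truncRpow a (m + 1)) (r x) * pdWithin K i r x * g x
      + truncRpow a (m + 1) (r x) * pdWithin K i g x) = 0 := fun m =>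
    integral_cutoff_eq_zero hΩo hΩb hr hr0 hg (contDiff_truncRpow a m.succ_pos)
      (ε := 1 / ((m + 1 : ℕ) : ℝ)) (by positivity) (fun s hs => truncRpow_of_le m.succ_pos hs) i
  have hpow : ∀ x ∈ Ω, r x ^ a = r x ^ (a - 1) * r x := fun x hx => by
    rw [Real.rpow_sub_one (hrpos x hx).ne', div_mul_cancel₀ _ (hrpos x hx).ne']
  have hlim := tendsto_integral_of_dominated_convergence (μ := volume.restrict Ω)
    (F := fun m : ℕ => fun x => deriv (truncRpow a (m + 1)) (r x) * pdWithin K i r x * g x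
      + truncRpow a (m + 1) (r x) * pdWithin K i g x)
    (f := fun x => r x ^ (a - 1) * weightedPd K r a i g x)
    (fun x => r x ^ (a - 1) * (C * |pdWithin K i r x * g x| + r x * |pdWithin K i g x|))
    ?_ ?_ ?_ ?_
  · simp only [hcut] at hlim
    exact tendsto_nhds_unique hlim tendsto_const_nhds
  · intro m
    have hψc := contDiff_truncRpow a m.succ_pos
    exact ((((((hψc.continuous_deriv (by simp)).comp_continuousOn hr.continuousOn).mul hDr).mul
      hg.continuousOn).add ((hψc.continuous.comp_continuousOn hr.continuousOn).mul
      hDg)).integrableOn_of_isBounded hΩb).aestronglyMeasurable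
  · exact integrableOn_rpow_mul hΩo hΩb hw
      ((continuousOn_const.mul (hDr.mul hg.continuousOn).abs).add (hr.continuousOn.mul hDg.abs))
  · intro m
    filter_upwards [ae_restrict_mem hΩo.measurableSet] with x hx
    have hr' := hrpos x hx
    refine (norm_add_le _ _).trans ?_
    rw [mul_add]
    refine add_le_add ?_ ?_
    · rw [mul_assoc, norm_mul, ← mul_assoc, mul_comm _ C]
      exact mul_le_mul_of_nonneg_right (hC _ _ hr') (abs_nonneg _)
    · rw [norm_mul, ← mul_assoc, ← hpow x hx]
      exact mul_le_mul_of_nonneg_right (abs_truncRpow_le hr'.le) (abs_nonneg _)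
  · filter_upwards [ae_restrict_mem hΩo.measurableSet] with x hx
    refine tendsto_const_nhds.congr' ?_
    filter_upwards [(tendsto_add_atTop_nat 1).eventually
      (eventually_truncRpow_eq a (hrpos x hx))] with m hm
    rw [hm.1, hm.2, hpow x hx, weightedPd]
    ring

end Weight

section Algebra

variable {H f₂ : Fin 3 → Fin 3 → ℝ} {V f₁ r₁ : Fin 3 → ℝ} {r a : ℝ}

theorem sum_energy_identity (B : Fin 3 → Fin 3 → ℝ) (f : ℝ) :
    ∑ i, ∑ j, (r * (B i j * (f * f₁ j) + H i j * (f₁ i * f₁ j + f * f₂ i j))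
        + a * r₁ i * (H i j * (f * f₁ j)))
      = r * ∑ i, ∑ j, H i j * (f₁ i * f₁ j)
        + f * ∑ i, ∑ j, H i j * (r * f₂ i j + a * r₁ i * f₁ j)
        + r * f * ∑ j, (∑ i, B i j) * f₁ j := by
  simp only [Fin.sum_univ_three]
  ring

theorem sum_rellich_identity (hH : ∀ i j, H i j = H j i) (hf : ∀ i j, f₂ i j = f₂ j i)
    (dA : Fin 3 → Fin 3 → Fin 3 → Fin 3 → ℝ) :
    ∑ i, ∑ j, ∑ l, ((r * (dA i i j l * (f₁ j * f₁ l)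
          + H i j * V l * (f₂ i j * f₁ l + f₁ j * f₂ i l))
        + a * r₁ i * (H i j * V l * (f₁ j * f₁ l)))
        - (1 / 2) * (r * (dA l i j l * (f₁ i * f₁ j)
          + H i j * V l * (f₂ l i * f₁ j + f₁ i * f₂ l j))
        + a * r₁ l * (H i j * V l * (f₁ i * f₁ j))))
      = (∑ i, ∑ j, H i j * (r * f₂ i j + a * r₁ i * f₁ j)) * ∑ l, V l * f₁ l
        + r * ∑ i, ∑ j, ∑ l, (dA i i j l * (f₁ j * f₁ l) - (1 / 2) * (dA l i j l * (f₁ i * f₁ j)))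
        - a / 2 * ((∑ l, r₁ l * V l) * ∑ i, ∑ j, H i j * (f₁ i * f₁ j)) := by
  simp only [Fin.sum_univ_three]
  rw [hH 1 0, hH 2 0, hH 2 1, hf 1 0, hf 2 0, hf 2 1]
  ring

/-- The combination of the energy and Rellich densities controls `g = |∇ f|²`. -/
theorem exists_coercive_constants {a lam c M : ℝ} (ha : 0 < a) (hlam : 0 < lam) (hc : 0 < c)
    (hM : 0 < M) : ∃ α C : ℝ, 0 < C ∧ ∀ r g P Q R b D F f : ℝ, 0 ≤ r → r ≤ M → 0 ≤ g → 0 ≤ P →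
      lam * g ≤ Q → c ≤ P + r → |R| ≤ M * g → b ^ 2 ≤ M * g → D ^ 2 ≤ M * g →
      a * c * lam / 4 * g ≤ C * (F ^ 2 + f ^ 2) + α * (r * Q + f * F + r * f * b)
        - (F * D + r * R - a / 2 * (P * Q)) := by
  set δ := a * c * lam / 4 with hδ
  have hδ0 : 0 < δ := by positivity
  set α := a + 2 * M / lam with hα
  have hα0 : 0 < α := by positivity
  have hαlam : α * lam = a * lam + 2 * M := by rw [hα]; field_simp
  refine ⟨α, M / (4 * δ) + α / 2 + α * (M ^ 2 / (2 * lam)), by positivity, ?_⟩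
  intro r g P Q R b D F f hr hrM hg hP hQ hPr hR hb hD
  have h1 : F * D ≤ δ * g + M / (4 * δ) * F ^ 2 := by
    have h : F * D ≤ δ / M * D ^ 2 + M / (4 * δ) * F ^ 2 := by
      have : δ / M * D ^ 2 + M / (4 * δ) * F ^ 2 - F * D
          = δ / M * (D - M / (2 * δ) * F) ^ 2 := by
        field_simp
        ring
      have h0 : 0 ≤ δ / M * (D - M / (2 * δ) * F) ^ 2 := by positivity
      linarith
    have h' : δ / M * D ^ 2 ≤ δ / M * (M * g) := mul_le_mul_of_nonneg_left hD (by positivity)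
    have h'' : δ / M * (M * g) = δ * g := by field_simp
    linarith
  have h2 : r * R ≤ r * (M * g) := mul_le_mul_of_nonneg_left ((le_abs_self R).trans hR) hr
  have h3 : a / 2 * (P * (lam * g)) ≤ a / 2 * (P * Q) :=
    mul_le_mul_of_nonneg_left (mul_le_mul_of_nonneg_left hQ hP) (by positivity)
  have h4 : α * (r * (lam * g)) ≤ α * (r * Q) :=
    mul_le_mul_of_nonneg_left (mul_le_mul_of_nonneg_left hQ hr) hα0.le
  have h5 : -(r * (lam / 2 * g) + M ^ 2 / (2 * lam) * f ^ 2) ≤ r * f * b := by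
    have h : -(f * b) ≤ lam / (2 * M) * b ^ 2 + M / (2 * lam) * f ^ 2 := by
      have : lam / (2 * M) * b ^ 2 + M / (2 * lam) * f ^ 2 + f * b
          = lam / (2 * M) * (b + M / lam * f) ^ 2 := by
        field_simp
        ring
      have h0 : 0 ≤ lam / (2 * M) * (b + M / lam * f) ^ 2 := by positivity
      linarith
    have h' : lam / (2 * M) * b ^ 2 ≤ lam / (2 * M) * (M * g) :=
      mul_le_mul_of_nonneg_left hb (by positivity)
    have h'' : lam / (2 * M) * (M * g) = lam / 2 * g := by field_simp
    have h6 : -(f * b) ≤ lam / 2 * g + M / (2 * lam) * f ^ 2 := by linarith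
    have h7 := mul_le_mul_of_nonneg_left h6 hr
    have h8 : r * (M / (2 * lam) * f ^ 2) ≤ M * (M / (2 * lam) * f ^ 2) :=
      mul_le_mul_of_nonneg_right hrM (by positivity)
    have h9 : M * (M / (2 * lam) * f ^ 2) = M ^ 2 / (2 * lam) * f ^ 2 := by ring
    linarith
  have h5' := mul_le_mul_of_nonneg_left h5 hα0.le
  have h6 : -(α / 2 * (f ^ 2 + F ^ 2)) ≤ α * (f * F) := by
    have : 0 ≤ α / 2 * (f + F) ^ 2 := by positivity
    linarith
  have h7 : a / 2 * (lam * g) * c ≤ a / 2 * (lam * g) * (P + r) :=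
    mul_le_mul_of_nonneg_left hPr (by positivity)
  have h8 : α * (r * (lam * g)) - α * (r * (lam / 2 * g)) = (a * lam + 2 * M) / 2 * (r * g) := by
    rw [← hαlam]; ring
  have h9 : 0 ≤ M / (4 * δ) * f ^ 2 := by positivity
  have h10 : 0 ≤ α * (M ^ 2 / (2 * lam)) * F ^ 2 := by positivity
  have h11 : δ * g = a * c * lam / 4 * g := by rw [hδ]
  linarith

end Algebra

section Bounds

variable {X : Type*} [TopologicalSpace X] {K : Set X}

theorem IsCompact.exists_pos_forall_le {φ : X → ℝ} (hK : IsCompact K) (hφ : ContinuousOn φ K)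
    (hpos : ∀ x ∈ K, 0 < φ x) : ∃ c > 0, ∀ x ∈ K, c ≤ φ x := by
  rcases K.eq_empty_or_nonempty with rfl | hne
  · exact ⟨1, one_pos, by simp⟩
  · obtain ⟨x₀, hx₀, hmin⟩ := hK.exists_isMinOn hne hφ
    exact ⟨φ x₀, hpos x₀ hx₀, fun x hx => hmin hx⟩

theorem IsCompact.exists_pos_forall_abs_le {ι : Type*} [Fintype ι] {φ : ι → X → ℝ}
    (hK : IsCompact K) (hφ : ∀ i, ContinuousOn (φ i) K) :
    ∃ M > 0, ∀ i, ∀ x ∈ K, |φ i x| ≤ M := by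
  obtain ⟨M, hM⟩ := hK.exists_bound_of_continuousOn
    (continuousOn_finsetSum Finset.univ fun i _ => (hφ i).abs)
  refine ⟨max M 1, lt_max_of_lt_right one_pos, fun i x hx => le_max_of_le_left ?_⟩
  refine le_trans ?_ ((le_abs_self _).trans (hM x hx))
  exact Finset.single_le_sum (f := fun i => |φ i x|) (fun i _ => abs_nonneg _) (Finset.mem_univ i)

end Bounds

theorem Hcoef_symm (u : (Fin 3 → ℝ) → Fin 4 → ℝ) (i j : Fin 3) (x : Fin 3 → ℝ) :
    Hcoef u i j x = Hcoef u j i x := by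
  simp only [Hcoef, eq_comm (a := i), mul_comm (u x i.succ)]

theorem Hcoef_lower_bound {u : (Fin 3 → ℝ) → Fin 4 → ℝ} {x : Fin 3 → ℝ} (hu0 : 0 < u x 0)
    (hunorm : -(u x 0) ^ 2 + (u x 1) ^ 2 + (u x 2) ^ 2 + (u x 3) ^ 2 = -1) (ξ : Fin 3 → ℝ) :
    ((u x 0) ^ 2)⁻¹ * ∑ i, ξ i ^ 2 ≤ ∑ i, ∑ j, Hcoef u i j x * (ξ i * ξ j) := by
  have hsum : ∑ i, ∑ j, Hcoef u i j x * (ξ i * ξ j)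
      = ∑ i, ξ i ^ 2 - ((u x 0) ^ 2)⁻¹ * (∑ i : Fin 3, u x i.succ * ξ i) ^ 2 := by
    simp [Hcoef, Fin.sum_univ_three]
    ring
  have hcs := Finset.sum_mul_sq_le_sq_mul_sq Finset.univ (fun i : Fin 3 => u x i.succ) ξ
  have hu : ∑ i : Fin 3, u x i.succ ^ 2 = (u x 0) ^ 2 - 1 := by
    have h1 : (Fin.succ (0 : Fin 3)) = 1 := rfl
    have h2 : (Fin.succ (1 : Fin 3)) = 2 := rfl
    have h3 : (Fin.succ (2 : Fin 3)) = 3 := rfl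
    rw [Fin.sum_univ_three, h1, h2, h3]
    linarith
  rw [hu] at hcs
  have hpos : 0 < ((u x 0) ^ 2)⁻¹ := by positivity
  have hmul := mul_le_mul_of_nonneg_left hcs hpos.le
  have hcancel : ((u x 0) ^ 2)⁻¹ * (((u x 0) ^ 2 - 1) * ∑ i, ξ i ^ 2)
      = ∑ i, ξ i ^ 2 - ((u x 0) ^ 2)⁻¹ * ∑ i, ξ i ^ 2 := by
    field_simp
  rw [hsum]
  linarith

theorem contDiffOn_Hcoef {K : Set (Fin 3 → ℝ)} {u : (Fin 3 → ℝ) → Fin 4 → ℝ}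
    (hu : ∀ α, ContDiffOn ℝ (⊤ : ℕ∞) (fun x => u x α) K) (hu0 : ∀ x ∈ K, 0 < u x 0)
    (i j : Fin 3) : ContDiffOn ℝ (⊤ : ℕ∞) (Hcoef u i j) K :=
  contDiffOn_const.sub (((hu _).mul (hu _)).div ((hu 0).pow 2)
    fun x hx => (pow_pos (hu0 x hx) 2).ne')

set_option maxHeartbeats 1000000 in
theorem weighted_gradient_estimate {Ω : Set (Fin 3 → ℝ)} {r : (Fin 3 → ℝ) → ℝ} {a : ℝ}
    (hΩo : IsOpen Ω) (hΩb : Bornology.IsBounded Ω)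
    (hK : UniqueDiffOn ℝ (closure Ω)) (hr : ContDiffOn ℝ (⊤ : ℕ∞) r (closure Ω))
    (hrpos : ∀ x ∈ Ω, 0 < r x) (hr0 : ∀ x ∈ frontier Ω, r x = 0)
    (hrgrad : ∀ x ∈ frontier Ω, 0 < ∑ i, pdWithin (closure Ω) i r x ^ 2) (ha : 0 < a)
    {H : Fin 3 → Fin 3 → (Fin 3 → ℝ) → ℝ}
    (hH : ∀ i j, ContDiffOn ℝ (⊤ : ℕ∞) (H i j) (closure Ω)) (hHs : ∀ i j x, H i j x = H j i x)
    {lam : ℝ} (hlam : 0 < lam) (hHpos : ∀ x ∈ closure Ω, ∀ ξ : Fin 3 → ℝ,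
      lam * ∑ i, ξ i ^ 2 ≤ ∑ i, ∑ j, H i j x * (ξ i * ξ j)) :
    IntegrableOn (fun x => r x ^ (a - 1)) Ω ∧
    ∃ C > 0, ∀ f : (Fin 3 → ℝ) → ℝ, ContDiffOn ℝ (⊤ : ℕ∞) f (closure Ω) →
      ∫ x in Ω, r x ^ (a - 1) * ∑ i, pdWithin (closure Ω) i f x ^ 2
        ≤ C * ∫ x in Ω, r x ^ (a - 1) * ((∑ i, ∑ j, H i j x *
          (r x * pdWithin (closure Ω) i (pdWithin (closure Ω) j f) x
            + a * pdWithin (closure Ω) i r x * pdWithin (closure Ω) j f x)) ^ 2 + f x ^ 2) := by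
  set K := closure Ω with hKdef
  have hKc : IsCompact K := hΩb.isCompact_closure
  have hrK := nonneg_on_closure hΩo hrpos hr0
  have hDr : ∀ i, ContDiffOn ℝ (⊤ : ℕ∞) (pdWithin K i r) K := fun i => hr.pdWithin hK i
  have hdich : ∀ x ∈ K, x ∈ Ω ∨ x ∈ frontier Ω := fun x hx => by
    rw [hΩo.frontier_eq]
    by_cases h : x ∈ Ω
    · exact Or.inl h
    · exact Or.inr ⟨hx, h⟩
  obtain ⟨c₀, hc₀, hc₀le⟩ := hKc.exists_pos_forall_le
    (φ := fun x => ∑ i, pdWithin K i r x ^ 2 + r x)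
    ((continuousOn_finsetSum _ fun i _ => (hDr i).continuousOn.pow 2).add hr.continuousOn) (by
      intro x hx
      rcases hdich x hx with h | h
      · exact add_pos_of_nonneg_of_pos (Finset.sum_nonneg fun i _ => sq_nonneg _) (hrpos x h)
      · exact add_pos_of_pos_of_nonneg (hrgrad x h) (hrK x hx))
  have hw : IntegrableOn (fun x => r x ^ (a - 1)) Ω :=
    integrableOn_rpow_sub_one hΩo hΩb hK hr hrpos hr0 ha hc₀
      fun x hx => hc₀le x (subset_closure hx)
  refine ⟨hw, ?_⟩
  set V : Fin 3 → (Fin 3 → ℝ) → ℝ := fun l x => ∑ k, H k l x * pdWithin K k r x with hV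
  have hVs : ∀ l, ContDiffOn ℝ (⊤ : ℕ∞) (V l) K := fun l =>
    ContDiffOn.sum fun k _ => (hH k l).mul (hDr k)
  set A : Fin 3 → Fin 3 → Fin 3 → (Fin 3 → ℝ) → ℝ := fun i j l x => H i j x * V l x with hA
  have hAs : ∀ i j l, ContDiffOn ℝ (⊤ : ℕ∞) (A i j l) K := fun i j l => (hH i j).mul (hVs l)
  set P : (Fin 3 → ℝ) → ℝ := fun x => ∑ l, pdWithin K l r x * V l x with hP
  have hPc : ContinuousOn P K :=
    continuousOn_finsetSum _ fun l _ => (hDr l).continuousOn.mul (hVs l).continuousOn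
  have hPge : ∀ x ∈ K, lam * ∑ i, pdWithin K i r x ^ 2 ≤ P x := by
    intro x hx
    refine (hHpos x hx fun i => pdWithin K i r x).trans_eq ?_
    simp only [hP, hV, Finset.mul_sum]
    rw [Finset.sum_comm]
    refine Finset.sum_congr rfl fun i _ => Finset.sum_congr rfl fun j _ => by ring
  have hPnn : ∀ x ∈ K, 0 ≤ P x := fun x hx =>
    le_trans (mul_nonneg hlam.le (Finset.sum_nonneg fun i _ => sq_nonneg _)) (hPge x hx)
  obtain ⟨c, hc, hcle⟩ := hKc.exists_pos_forall_le (φ := fun x => P x + r x)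
    (hPc.add hr.continuousOn) (by
      intro x hx
      rcases hdich x hx with h | h
      · exact add_pos_of_nonneg_of_pos (hPnn x hx) (hrpos x h)
      · exact add_pos_of_pos_of_nonneg
          (lt_of_lt_of_le (mul_pos hlam (hrgrad x h)) (hPge x hx)) (hrK x hx))
  set B : Fin 3 → (Fin 3 → ℝ) → ℝ := fun j x => ∑ i, pdWithin K i (H i j) x with hB
  have hBc : ∀ j, ContinuousOn (B j) K := fun j =>
    continuousOn_finsetSum _ fun i _ => ((hH i j).pdWithin hK i).continuousOn
  obtain ⟨M₁, hM₁, hM₁le⟩ := hKc.exists_pos_forall_abs_le (φ := fun _ : Unit => r)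
    fun _ => hr.continuousOn
  obtain ⟨M₂, hM₂, hM₂le⟩ := hKc.exists_pos_forall_abs_le
    (φ := fun _ : Unit => fun x => ∑ j, B j x ^ 2)
    fun _ => continuousOn_finsetSum _ fun j _ => (hBc j).pow 2
  obtain ⟨M₃, hM₃, hM₃le⟩ := hKc.exists_pos_forall_abs_le
    (φ := fun _ : Unit => fun x => ∑ l, V l x ^ 2)
    fun _ => continuousOn_finsetSum _ fun l _ => (hVs l).continuousOn.pow 2
  obtain ⟨M₄, hM₄, hM₄le⟩ := hKc.exists_pos_forall_abs_le
    (φ := fun p : Fin 3 × Fin 3 × Fin 3 × Fin 3 => pdWithin K p.1 (A p.2.1 p.2.2.1 p.2.2.2))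
    fun p => ((hAs _ _ _).pdWithin hK _).continuousOn
  set M := M₁ + M₂ + M₃ + 41 * M₄ with hM
  have hM0 : 0 < M := by positivity
  obtain ⟨α, C, hC, hco⟩ := exists_coercive_constants ha hlam hc hM0
  have hδ : 0 < a * c * lam / 4 := by positivity
  refine ⟨(a * c * lam / 4)⁻¹ * C, by positivity, fun f hf => ?_⟩
  have hDf : ∀ i, ContDiffOn ℝ (⊤ : ℕ∞) (pdWithin K i f) K := fun i => hf.pdWithin hK i
  have hDDf : ∀ i j, ContDiffOn ℝ (⊤ : ℕ∞) (pdWithin K i (pdWithin K j f)) K :=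
    fun i j => (hDf j).pdWithin hK i
  set F : (Fin 3 → ℝ) → ℝ := fun x => ∑ i, ∑ j, H i j x *
    (r x * pdWithin K i (pdWithin K j f) x + a * pdWithin K i r x * pdWithin K j f x) with hF
  have hFc : ContinuousOn F K := continuousOn_finsetSum _ fun i _ => continuousOn_finsetSum _
    fun j _ => (hH i j).continuousOn.mul ((hr.continuousOn.mul (hDDf i j).continuousOn).add
      ((continuousOn_const.mul (hDr i).continuousOn).mul (hDf j).continuousOn))
  have hI : ∀ {g : (Fin 3 → ℝ) → ℝ}, ContinuousOn g K →
      IntegrableOn (fun x => r x ^ (a - 1) * g x) Ω := fun hg =>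
    integrableOn_rpow_mul hΩo hΩb hw hg
  have hibp : ∀ {g : (Fin 3 → ℝ) → ℝ} (i : Fin 3), ContDiffOn ℝ (⊤ : ℕ∞) g K →
      ∫ x in Ω, r x ^ (a - 1) * weightedPd K r a i g x = 0 := fun i hg =>
    integral_rpow_mul_weightedPd hΩo hΩb hK hr hrpos hr0 ha hw hg i
  set G₁ : Fin 3 → Fin 3 → (Fin 3 → ℝ) → ℝ := fun i j x => H i j x * (f x * pdWithin K j f x)
    with hG₁
  have hG₁s : ∀ i j, ContDiffOn ℝ (⊤ : ℕ∞) (G₁ i j) K := fun i j => (hH i j).mul (hf.mul (hDf j))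
  set G₂ : Fin 3 → Fin 3 → Fin 3 → Fin 3 → Fin 3 → (Fin 3 → ℝ) → ℝ := fun i j l p q x =>
    A i j l x * (pdWithin K p f x * pdWithin K q f x) with hG₂
  have hG₂s : ∀ i j l p q, ContDiffOn ℝ (⊤ : ℕ∞) (G₂ i j l p q) K := fun i j l p q =>
    (hAs i j l).mul ((hDf p).mul (hDf q))
  set E₁ : (Fin 3 → ℝ) → ℝ := fun x => ∑ i, ∑ j, weightedPd K r a i (G₁ i j) x with hE₁
  set E₂ : (Fin 3 → ℝ) → ℝ := fun x => ∑ i, ∑ j, ∑ l, (weightedPd K r a i (G₂ i j l j l) x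
    - (1 / 2) * weightedPd K r a l (G₂ i j l i j) x) with hE₂
  have hwc : ∀ {g : (Fin 3 → ℝ) → ℝ} (i : Fin 3), ContDiffOn ℝ (⊤ : ℕ∞) g K →
      ContinuousOn (weightedPd K r a i g) K := fun i hg => continuousOn_weightedPd hK hr hg i
  have hE₁c : ContinuousOn E₁ K := continuousOn_finsetSum _ fun i _ =>
    continuousOn_finsetSum _ fun j _ => hwc i (hG₁s i j)
  have hE₂c : ContinuousOn E₂ K := continuousOn_finsetSum _ fun i _ =>
    continuousOn_finsetSum _ fun j _ => continuousOn_finsetSum _ fun l _ =>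
      (hwc i (hG₂s i j l j l)).sub (continuousOn_const.mul (hwc l (hG₂s i j l i j)))
  have hE₁0 : ∫ x in Ω, r x ^ (a - 1) * E₁ x = 0 := by
    simp only [hE₁, Finset.mul_sum]
    rw [integral_finsetSum _ fun i _ => integrable_finsetSum _ fun j _ => hI (hwc i (hG₁s i j))]
    refine Finset.sum_eq_zero fun i _ => ?_
    rw [integral_finsetSum _ fun j _ => hI (hwc i (hG₁s i j))]
    exact Finset.sum_eq_zero fun j _ => hibp i (hG₁s i j)
  have hE₂i : ∀ i j l, IntegrableOn (fun x => r x ^ (a - 1) * (weightedPd K r a i (G₂ i j l j l) x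
      - (1 / 2) * weightedPd K r a l (G₂ i j l i j) x)) Ω := fun i j l =>
    hI ((hwc i (hG₂s i j l j l)).sub (continuousOn_const.mul (hwc l (hG₂s i j l i j))))
  have hE₂0 : ∫ x in Ω, r x ^ (a - 1) * E₂ x = 0 := by
    simp only [hE₂, Finset.mul_sum]
    rw [integral_finsetSum _ fun i _ => integrable_finsetSum _ fun j _ =>
      integrable_finsetSum _ fun l _ => hE₂i i j l]
    refine Finset.sum_eq_zero fun i _ => ?_
    rw [integral_finsetSum _ fun j _ => integrable_finsetSum _ fun l _ => hE₂i i j l]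
    refine Finset.sum_eq_zero fun j _ => ?_
    rw [integral_finsetSum _ fun l _ => hE₂i i j l]
    refine Finset.sum_eq_zero fun l _ => ?_
    have h1 := hI (hwc i (hG₂s i j l j l))
    have h2 := (hI (hwc l (hG₂s i j l i j))).const_mul (1 / 2)
    have h3 := integral_sub h1 h2
    rw [integral_const_mul, hibp i (hG₂s i j l j l), hibp l (hG₂s i j l i j)] at h3
    calc _ = _ := integral_congr_ae (ae_of_all _ fun x => by ring)
      _ = _ := h3
      _ = 0 := by norm_num
  set g : (Fin 3 → ℝ) → ℝ := fun x => ∑ i, pdWithin K i f x ^ 2 with hg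
  have hgc : ContinuousOn g K := continuousOn_finsetSum _ fun i _ => (hDf i).continuousOn.pow 2
  have hpt : ∀ x ∈ Ω, a * c * lam / 4 * g x ≤ C * (F x ^ 2 + f x ^ 2) + α * E₁ x - E₂ x := by
    intro x hxΩ
    have hx : x ∈ K := subset_closure hxΩ
    have hgnn : 0 ≤ g x := Finset.sum_nonneg fun i _ => sq_nonneg _
    have hsymm : ∀ i j, pdWithin K i (pdWithin K j f) x = pdWithin K j (pdWithin K i f) x :=
      fun i j => pdWithin_comm hΩo subset_closure hf i j hxΩ
    have e₁ : E₁ x = r x * ∑ i, ∑ j, H i j x * (pdWithin K i f x * pdWithin K j f x)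
        + f x * F x + r x * f x * ∑ j, B j x * pdWithin K j f x := by
      have key := sum_energy_identity (H := fun i j => H i j x) (r := r x) (a := a)
        (f₂ := fun i j => pdWithin K i (pdWithin K j f) x) (f₁ := fun i => pdWithin K i f x)
        (r₁ := fun i => pdWithin K i r x) (fun i j => pdWithin K i (H i j) x) (f x)
      refine Eq.trans ?_ key
      exact Finset.sum_congr rfl fun i _ => Finset.sum_congr rfl fun j _ =>
        weightedPd_mul_mul hK (hH i j) hf (hDf j) i hx
    have e₂ : E₂ x = F x * ∑ l, V l x * pdWithin K l f x
        + r x * ∑ i, ∑ j, ∑ l, (pdWithin K i (A i j l) x * (pdWithin K j f x * pdWithin K l f x)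
          - (1 / 2) * (pdWithin K l (A i j l) x * (pdWithin K i f x * pdWithin K j f x)))
        - a / 2 * (P x * ∑ i, ∑ j, H i j x * (pdWithin K i f x * pdWithin K j f x)) := by
      have key := sum_rellich_identity (V := fun l => V l x) (f₁ := fun i => pdWithin K i f x)
        (r₁ := fun i => pdWithin K i r x) (r := r x) (a := a) (fun i j => hHs i j x) hsymm
        (fun k i j l => pdWithin K k (A i j l) x)
      refine Eq.trans ?_ key
      refine Finset.sum_congr rfl fun i _ => Finset.sum_congr rfl fun j _ =>
        Finset.sum_congr rfl fun l _ => ?_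
      rw [weightedPd_mul_mul hK (hAs i j l) (hDf j) (hDf l) i hx,
        weightedPd_mul_mul hK (hAs i j l) (hDf i) (hDf j) l hx]
    rw [e₁, e₂]
    have hM₁' := (le_abs_self _).trans (hM₁le () x hx)
    have hM₂' := (le_abs_self _).trans (hM₂le () x hx)
    have hM₃' := (le_abs_self _).trans (hM₃le () x hx)
    refine hco (r x) (g x) (P x) _ _ _ _ (F x) (f x) (hrK x hx) ?_ hgnn (hPnn x hx)
      (hHpos x hx _) (hcle x hx) ?_ ?_ ?_
    · rw [hM]; linarith
    · have hprod : ∀ i j, |pdWithin K i f x * pdWithin K j f x| ≤ g x := by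
        intro i j
        have hi : pdWithin K i f x ^ 2 ≤ g x :=
          Finset.single_le_sum (f := fun i => pdWithin K i f x ^ 2)
            (fun i _ => sq_nonneg _) (Finset.mem_univ i)
        have hj : pdWithin K j f x ^ 2 ≤ g x :=
          Finset.single_le_sum (f := fun i => pdWithin K i f x ^ 2)
            (fun i _ => sq_nonneg _) (Finset.mem_univ j)
        rw [abs_le]
        constructor <;> nlinarith [sq_nonneg (pdWithin K i f x + pdWithin K j f x),
          sq_nonneg (pdWithin K i f x - pdWithin K j f x)]
      have hterm : ∀ k i j l p q, |pdWithin K k (A i j l) x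
          * (pdWithin K p f x * pdWithin K q f x)| ≤ M₄ * g x := by
        intro k i j l p q
        rw [abs_mul]
        exact mul_le_mul (hM₄le (k, i, j, l) x hx) (hprod p q) (abs_nonneg _) hM₄.le
      calc _ ≤ ∑ _i : Fin 3, ∑ _j : Fin 3, ∑ _l : Fin 3, (3 / 2) * (M₄ * g x) := by
            refine (Finset.abs_sum_le_sum_abs _ _).trans (Finset.sum_le_sum fun i _ => ?_)
            refine (Finset.abs_sum_le_sum_abs _ _).trans (Finset.sum_le_sum fun j _ => ?_)
            refine (Finset.abs_sum_le_sum_abs _ _).trans (Finset.sum_le_sum fun l _ => ?_)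
            refine (abs_sub _ _).trans ?_
            rw [abs_mul (1 / 2)]
            have h1 := hterm i i j l j l
            have h2 := hterm l i j l i j
            rw [abs_of_pos (by norm_num : (0:ℝ) < 1 / 2)]
            linarith
        _ ≤ M * g x := by
            simp only [Finset.sum_const, Finset.card_univ, Fintype.card_fin, nsmul_eq_mul]
            have := mul_nonneg (add_pos (add_pos hM₁ hM₂) hM₃).le hgnn
            have := mul_nonneg hM₄.le hgnn
            rw [hM]
            push_cast
            nlinarith
    · refine (Finset.sum_mul_sq_le_sq_mul_sq _ _ _).trans (mul_le_mul_of_nonneg_right ?_ hgnn)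
      rw [hM]; linarith
    · refine (Finset.sum_mul_sq_le_sq_mul_sq _ _ _).trans (mul_le_mul_of_nonneg_right ?_ hgnn)
      rw [hM]; linarith
  have hq : ContinuousOn (fun x => F x ^ 2 + f x ^ 2) K :=
    (hFc.pow 2).add (hf.continuousOn.pow 2)
  have hintegral : a * c * lam / 4 * ∫ x in Ω, r x ^ (a - 1) * g x
      ≤ C * ∫ x in Ω, r x ^ (a - 1) * (F x ^ 2 + f x ^ 2) := by
    have hi₁ := (hI hq).const_mul C
    have hi₂ := (hI hE₁c).const_mul α
    have hi₃ := hI hE₂c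
    calc _ = ∫ x in Ω, a * c * lam / 4 * (r x ^ (a - 1) * g x) := (integral_const_mul _ _).symm
      _ ≤ ∫ x in Ω, (C * (r x ^ (a - 1) * (F x ^ 2 + f x ^ 2)) + α * (r x ^ (a - 1) * E₁ x)
          - r x ^ (a - 1) * E₂ x) := by
        refine setIntegral_mono_on ((hI hgc).const_mul _) ((hi₁.add hi₂).sub hi₃)
          hΩo.measurableSet fun x hx => ?_
        have := mul_le_mul_of_nonneg_left (hpt x hx) (Real.rpow_nonneg (hrpos x hx).le (a - 1))
        linarith
      _ = _ := by
        have h1 := integral_sub (hi₁.add hi₂) hi₃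
        have h2 := integral_add hi₁ hi₂
        simp only [Pi.add_apply] at h1
        rw [h1, h2, integral_const_mul, integral_const_mul, hE₁0, hE₂0]
        ring
  rw [mul_assoc, le_inv_mul_iff₀ hδ]
  exact hintegral

theorem rSobNorm_zero (Ω : Set (Fin 3 → ℝ)) (r f : (Fin 3 → ℝ) → ℝ) (σ : ℝ) :
    rSobNorm Ω r 0 σ f = √(∫ x in Ω, r x ^ (2 * σ) * f x ^ 2) := by
  simp [rSobNorm, mderiv]

theorem rSobNorm_one (Ω : Set (Fin 3 → ℝ)) (r f : (Fin 3 → ℝ) → ℝ) (σ : ℝ) :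
    rSobNorm Ω r 1 σ f = √((∫ x in Ω, r x ^ (2 * σ) * f x ^ 2)
      + ∑ i, ∫ x in Ω, r x ^ (2 * σ) * pd i f x ^ 2) := by
  have h : ∑ β : Fin 1 → Fin 3, ∫ x in Ω, r x ^ (2 * σ) * mderiv β f x ^ 2
      = ∑ i, ∫ x in Ω, r x ^ (2 * σ) * pd i f x ^ 2 :=
    Fintype.sum_equiv (Equiv.funUnique (Fin 1) (Fin 3)) _ _ fun β => by simp [mderiv]
  rw [rSobNorm, Finset.sum_range_succ, Finset.sum_range_one, h]
  simp [mderiv]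

theorem exists_apply_single_ne_zero {n : ℕ} {L : (Fin n → ℝ) →L[ℝ] ℝ} (hL : L ≠ 0) :
    ∃ i, L (Pi.single i 1) ≠ 0 := by
  by_contra! h
  refine hL (ContinuousLinearMap.ext fun v => ?_)
  have hv : v = ∑ i, v i • (Pi.single i (1:ℝ) : Fin n → ℝ) := by
    ext j
    simp [Finset.sum_apply, Pi.single_apply]
  rw [hv, map_sum]
  simp [h]

/-- **First-order weighted elliptic estimate for `L̃₁`** (inequality (3.7) of the paper):
`‖f‖_{H^{1,1/(2κ)-1/2}} ≲ ‖L̃₁ f‖_{H^{0,1/(2κ)-1/2}} + ‖f‖_{H^{0,1/(2κ)-1/2}}`. -/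
theorem first_order_elliptic_estimate_L1 (Ω : Set (Fin 3 → ℝ))
    (hΩo : IsOpen Ω) (hΩb : Bornology.IsBounded Ω) (hΩs : HasSmoothBoundary Ω)
    (κ : ℝ) (hκ : 0 < κ)
    (r : (Fin 3 → ℝ) → ℝ) (hr : ContDiffOn ℝ (⊤ : ℕ∞) r (closure Ω))
    (hrpos : ∀ x ∈ Ω, 0 < r x) (hr0 : ∀ x ∈ frontier Ω, r x = 0)
    (hrgrad : ∀ x ∈ frontier Ω, fderiv ℝ r x ≠ 0)
    (u : (Fin 3 → ℝ) → Fin 4 → ℝ)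
    (hu : ∀ α, ContDiffOn ℝ (⊤ : ℕ∞) (fun x => u x α) (closure Ω))
    (hu0 : ∀ x ∈ closure Ω, 0 < u x 0)
    (hunorm : ∀ x ∈ closure Ω,
      -(u x 0) ^ 2 + (u x 1) ^ 2 + (u x 2) ^ 2 + (u x 3) ^ 2 = -1) :
    ∃ C > 0, ∀ f : (Fin 3 → ℝ) → ℝ, ContDiffOn ℝ (⊤ : ℕ∞) f (closure Ω) →
      rSobNorm Ω r 1 (1/(2*κ) - 1/2) f
        ≤ C * (rSobNorm Ω r 0 (1/(2*κ) - 1/2) (L1t κ r u f)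
            + rSobNorm Ω r 0 (1/(2*κ) - 1/2) f) := by
  have hK := uniqueDiffOn_closure_of_hasSmoothBoundary hΩo hΩs
  set K := closure Ω with hKdef
  have hgrad : ∀ x ∈ frontier Ω, 0 < ∑ i, pdWithin K i r x ^ 2 := by
    intro x hx
    obtain ⟨i, hi⟩ := exists_apply_single_ne_zero (hrgrad x hx)
    have hd : DifferentiableAt ℝ r x := by
      by_contra h
      exact hrgrad x hx (fderiv_zero_of_not_differentiableAt h)
    have hpd : pdWithin K i r x ≠ 0 := by
      rwa [pdWithin, hd.fderivWithin (hK x (frontier_subset_closure hx))]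
    exact Finset.sum_pos' (fun i _ => sq_nonneg _) ⟨i, Finset.mem_univ i, by positivity⟩
  obtain ⟨lam, hlam, hlamle⟩ := hΩb.isCompact_closure.exists_pos_forall_le
    (φ := fun x => ((u x 0) ^ 2)⁻¹)
    (((hu 0).continuousOn.pow 2).inv₀ fun x hx => (pow_pos (hu0 x hx) 2).ne')
    fun x hx => inv_pos.2 (pow_pos (hu0 x hx) 2)
  obtain ⟨hw, C, hC, hest⟩ := weighted_gradient_estimate hΩo hΩb hK hr hrpos hr0 hgrad
    (a := 1 / κ) (by positivity) (contDiffOn_Hcoef hu hu0) (Hcoef_symm u) hlam fun x hx ξ =>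
      (mul_le_mul_of_nonneg_right (hlamle x hx)
        (Finset.sum_nonneg fun i _ => sq_nonneg _)).trans
        (Hcoef_lower_bound (hu0 x hx) (hunorm x hx) ξ)
  refine ⟨√(C + 1), Real.sqrt_pos.2 (by linarith), fun f hf => ?_⟩
  have hσ : 2 * (1 / (2 * κ) - 1 / 2) = 1 / κ - 1 := by field_simp
  rw [rSobNorm_one, rSobNorm_zero, rSobNorm_zero, hσ]
  have hDr : ∀ i, ContinuousOn (pdWithin K i r) K := fun i => (hr.pdWithin hK i).continuousOn
  have hDf : ∀ i, ContinuousOn (pdWithin K i f) K := fun i => (hf.pdWithin hK i).continuousOn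
  have hDDf : ∀ i j, ContinuousOn (pdWithin K i (pdWithin K j f)) K := fun i j =>
    ((hf.pdWithin hK j).pdWithin hK i).continuousOn
  set F : (Fin 3 → ℝ) → ℝ := fun x => ∑ i, ∑ j, Hcoef u i j x *
    (r x * pdWithin K i (pdWithin K j f) x + 1 / κ * pdWithin K i r x * pdWithin K j f x) with hF
  have hFc : ContinuousOn F K := continuousOn_finsetSum _ fun i _ => continuousOn_finsetSum _
    fun j _ => (contDiffOn_Hcoef hu hu0 i j).continuousOn.mul
      ((hr.continuousOn.mul (hDDf i j)).add ((continuousOn_const.mul (hDr i)).mul (hDf j)))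
  have hnhds : ∀ x ∈ Ω, K ∈ 𝓝 x := fun x hx =>
    mem_of_superset (hΩo.mem_nhds hx) subset_closure
  have hL : ∀ x ∈ Ω, L1t κ r u f x = (κ + 1) * F x := by
    intro x hx
    simp only [L1t, hF]
    congr 1
    refine Finset.sum_congr rfl fun i _ => Finset.sum_congr rfl fun j _ => ?_
    rw [pdWithin_pdWithin_eq_pd_pd hΩo subset_closure f i j hx,
      pdWithin_eq_pd_of_mem_nhds r i (hnhds x hx), pdWithin_eq_pd_of_mem_nhds f j (hnhds x hx)]
  have hgradeq : ∑ i, ∫ x in Ω, r x ^ (1 / κ - 1) * pd i f x ^ 2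
      = ∫ x in Ω, r x ^ (1 / κ - 1) * ∑ i, pdWithin K i f x ^ 2 := by
    simp only [Finset.mul_sum]
    rw [integral_finsetSum _ fun i _ => integrableOn_rpow_mul
      (g := fun x => pdWithin K i f x ^ 2) hΩo hΩb hw ((hDf i).pow 2)]
    refine Finset.sum_congr rfl fun i _ => setIntegral_congr_fun hΩo.measurableSet fun x hx => ?_
    simp only [pdWithin_eq_pd_of_mem_nhds _ _ (hnhds x hx)]
  have hiF := integrableOn_rpow_mul (g := fun x => F x ^ 2) hΩo hΩb hw (hFc.pow 2)
  have hif := integrableOn_rpow_mul (g := fun x => f x ^ 2) hΩo hΩb hw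
    (hf.continuousOn.pow 2)
  have hwnn : ∀ (q : (Fin 3 → ℝ) → ℝ), 0 ≤ ∫ x in Ω, r x ^ (1 / κ - 1) * q x ^ 2 := fun q =>
    setIntegral_nonneg hΩo.measurableSet fun x hx =>
      mul_nonneg (Real.rpow_nonneg (hrpos x hx).le _) (sq_nonneg _)
  have hLF : ∫ x in Ω, r x ^ (1 / κ - 1) * F x ^ 2
      ≤ ∫ x in Ω, r x ^ (1 / κ - 1) * L1t κ r u f x ^ 2 := by
    have h : ∫ x in Ω, r x ^ (1 / κ - 1) * L1t κ r u f x ^ 2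
        = (κ + 1) ^ 2 * ∫ x in Ω, r x ^ (1 / κ - 1) * F x ^ 2 := by
      rw [← integral_const_mul]
      refine setIntegral_congr_fun hΩo.measurableSet fun x hx => ?_
      simp only [hL x hx]
      ring
    rw [h]
    exact le_mul_of_one_le_left (hwnn F) (by nlinarith)
  have hsplit : ∫ x in Ω, r x ^ (1 / κ - 1) * (F x ^ 2 + f x ^ 2)
      = (∫ x in Ω, r x ^ (1 / κ - 1) * F x ^ 2) + ∫ x in Ω, r x ^ (1 / κ - 1) * f x ^ 2 := by
    rw [← integral_add hiF hif]
    simp only [mul_add]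
  have hest' := hest f hf
  rw [hsplit, ← hgradeq] at hest'
  set X := ∫ x in Ω, r x ^ (1 / κ - 1) * f x ^ 2
  set Y := ∫ x in Ω, r x ^ (1 / κ - 1) * L1t κ r u f x ^ 2
  have hX : 0 ≤ X := hwnn f
  have hY : 0 ≤ Y := hwnn _
  calc _ ≤ √((C + 1) * (Y + X)) := by
        refine Real.sqrt_le_sqrt ?_
        have := mul_le_mul_of_nonneg_left (add_le_add hLF le_rfl : _ + X ≤ Y + X) hC.le
        linarith
    _ = √(C + 1) * √(Y + X) := Real.sqrt_mul (by linarith) _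
    _ ≤ _ := by
        refine mul_le_mul_of_nonneg_left ?_ (Real.sqrt_nonneg _)
        refine Real.sqrt_le_iff.2 ⟨by positivity, ?_⟩
        nlinarith [Real.sq_sqrt hX, Real.sq_sqrt hY,
          mul_nonneg (Real.sqrt_nonneg Y) (Real.sqrt_nonneg X)]
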